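/- arXiv:2605.08099 — 4 statements merged into one kernel-verified Lean document; each statement's English description precedes it below -/
import Mathlib

section
/- Let I be a finite index set, and for each i ∈ I let Dᵢ be a division ring and nᵢ ≥ 1 a positive integer. Let R = ∏_{i ∈ I} M_{nᵢ}(Dᵢ) be the product of the full matrix rings M_{nᵢ}(Dᵢ). Then every R-module is a C4*-module. -/
/-- A submodule `N` of `M` is a direct summand if it admits a complementary submodule. -/
def IsDirectSummand {R M : Type*} [Ring R] [AddCommGroup M] [Module R M]
    (N : Submodule R M) : Prop :=
  ∃ N' : Submodule R M, IsCompl N N'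

/-- `M` is a C4-module: for every internal direct sum decomposition `M = X ⊕ Y` and every
`R`-homomorphism `f : X → Y` whose kernel is a direct summand of `X`, the image of `f`
is a direct summand of `Y`. -/
def IsC4Module (R M : Type*) [Ring R] [AddCommGroup M] [Module R M] : Prop :=
  ∀ (X Y : Submodule R M), IsCompl X Y → ∀ f : X →ₗ[R] Y,
    IsDirectSummand (LinearMap.ker f) → IsDirectSummand (LinearMap.range f)

/-- `M` is a C4*-module: every submodule of `M` is a C4-module. -/
def IsC4StarModule (R M : Type*) [Ring R] [AddCommGroup M] [Module R M] : Prop :=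
  ∀ N : Submodule R M, IsC4Module R N

/-- Over a semisimple ring every module is a C4*-module. -/
theorem isC4StarModule_of_isSemisimpleRing (R M : Type*) [Ring R] [IsSemisimpleRing R]
    [AddCommGroup M] [Module R M] : IsC4StarModule R M :=
  fun _ _ _ _ f _ => exists_isCompl (LinearMap.range f)

/-- Every module over a finite product of full matrix rings over division rings
is a C4*-module. -/
theorem isC4StarModule_of_prod_matrixRings {I : Type*} [Finite I]
    (D : I → Type*) [∀ i, DivisionRing (D i)] (n : I → ℕ) (hn : ∀ i, 1 ≤ n i)
    (M : Type*) [AddCommGroup M]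
    [Module (∀ i, Matrix (Fin (n i)) (Fin (n i)) (D i)) M] :
    IsC4StarModule (∀ i, Matrix (Fin (n i)) (Fin (n i)) (D i)) M := by
  exact isC4StarModule_of_isSemisimpleRing _ M
end

section
/- Let R be a ring, let M be an R-module, and let M = M₁ ⊕ M₂ ⊕ ⋯ ⊕ Mₙ be an internal direct sum decomposition of M into finitely many submodules M₁, …, Mₙ. If M is a C4*-module, then each Mᵢ is a C4*-module. -/
/-- Being a direct summand is preserved by linear equivalences. -/
theorem IsDirectSummand.map_equiv {R A B : Type*} [Ring R] [AddCommGroup A] [Module R A]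
    [AddCommGroup B] [Module R B] (e : A ≃ₗ[R] B) {N : Submodule R A}
    (h : IsDirectSummand N) : IsDirectSummand (N.map (e : A →ₗ[R] B)) := by
  obtain ⟨N', hN⟩ := h
  exact ⟨N'.map (e : A →ₗ[R] B), (Submodule.orderIsoMapComap e).isCompl hN⟩

/-- Being a C4-module is invariant under linear equivalences. -/
theorem IsC4Module.of_equiv {R A B : Type*} [Ring R] [AddCommGroup A] [Module R A]
    [AddCommGroup B] [Module R B] (e : A ≃ₗ[R] B) (hA : IsC4Module R A) : IsC4Module R B := by
  intro X Y hXY f hf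
  let eX := e.symm.submoduleMap X
  let eY := e.symm.submoduleMap Y
  have hker : LinearMap.ker (eY.toLinearMap ∘ₗ f ∘ₗ eX.symm.toLinearMap) =
      (LinearMap.ker f).map eX.toLinearMap := by
    rw [LinearEquiv.ker_comp, LinearMap.ker_comp]
    exact (Submodule.map_equiv_eq_comap_symm eX _).symm
  have hrange : LinearMap.range (eY.toLinearMap ∘ₗ f ∘ₗ eX.symm.toLinearMap) =
      (LinearMap.range f).map eY.toLinearMap := by
    rw [LinearMap.range_comp, LinearEquiv.range_comp]
  have h := hA _ _ ((Submodule.orderIsoMapComap e.symm).isCompl hXY)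
    (eY.toLinearMap ∘ₗ f ∘ₗ eX.symm.toLinearMap) (hker ▸ hf.map_equiv eX)
  have h' := (hrange ▸ h).map_equiv eY.symm
  rwa [← Submodule.map_comp, LinearEquiv.symm_comp, Submodule.map_id] at h'

/-- Every submodule of a C4*-module is a C4*-module. -/
theorem IsC4StarModule.submodule {R M : Type*} [Ring R] [AddCommGroup M] [Module R M]
    (hM : IsC4StarModule R M) (P : Submodule R M) : IsC4StarModule R P := fun N ↦
  (hM (N.map P.subtype)).of_equiv (N.equivMapOfInjective P.subtype P.subtype_injective).symm

/-- If `M = M₁ ⊕ ⋯ ⊕ Mₙ` is an internal direct sum decomposition of a C4*-module `M`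
into finitely many submodules, then each `Mᵢ` is a C4*-module. -/
theorem isC4StarModule_of_finite_internal_directSum
    {R M : Type*} [Ring R] [AddCommGroup M] [Module R M]
    {n : ℕ} (Mi : Fin n → Submodule R M)
    (hindep : iSupIndep Mi) (hsup : ⨆ i, Mi i = ⊤)
    (hM : IsC4StarModule R M) :
    ∀ i, IsC4StarModule R (Mi i) := by
  exact fun i ↦ hM.submodule (Mi i)
end

section
/- The ℤ-module ℚ is a C4*-module: every ℤ-submodule of ℚ is a C4-module. -/
theorem isC4Module_of_disjoint_imp {R M : Type*} [Ring R] [AddCommGroup M] [Module R M]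
    (h : ∀ X Y : Submodule R M, Disjoint X Y → X = ⊥ ∨ Y = ⊥) : IsC4Module R M := by
  intro X Y hXY f _
  have hf : f = 0 := by
    rcases h X Y hXY.disjoint with rfl | rfl <;> exact Subsingleton.elim _ _
  rw [hf, LinearMap.range_zero]
  exact ⟨⊤, isCompl_bot_top⟩

theorem Rat.exists_zsmul_eq_zsmul_ne_zero {x y : ℚ} (hx : x ≠ 0) (hy : y ≠ 0) :
    ∃ m n : ℤ, m • x = n • y ∧ m • x ≠ 0 := by
  have hxd : (x.den : ℚ) ≠ 0 := by exact_mod_cast x.den_ne_zero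
  have hyn : (y.num : ℚ) ≠ 0 := by exact_mod_cast Rat.num_ne_zero.mpr hy
  refine ⟨y.num * x.den, x.num * y.den, ?_, ?_⟩
  · simp only [zsmul_eq_mul]
    push_cast
    linear_combination (y.num : ℚ) * x.den_mul_eq_num - (x.num : ℚ) * y.den_mul_eq_num
  · simp only [zsmul_eq_mul]
    push_cast
    exact mul_ne_zero (mul_ne_zero hyn hxd) hx

/-- The ℤ-module ℚ is a C4*-module: every ℤ-submodule of ℚ is a C4-module. -/
theorem rat_isC4StarModule : IsC4StarModule ℤ ℚ := by
  intro N
  refine isC4Module_of_disjoint_imp fun X Y hXY => ?_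
  by_contra! hne
  obtain ⟨x, hxX, hx⟩ := X.ne_bot_iff.mp hne.1
  obtain ⟨y, hyY, hy⟩ := Y.ne_bot_iff.mp hne.2
  obtain ⟨m, n, hmn, hm⟩ := Rat.exists_zsmul_eq_zsmul_ne_zero
    (fun h => hx (Subtype.ext h) : (x : ℚ) ≠ 0) (fun h => hy (Subtype.ext h) : (y : ℚ) ≠ 0)
  have hmn' : m • x = n • y := Subtype.ext hmn
  have h0 : m • x = 0 := Submodule.disjoint_def.mp hXY _ (X.smul_mem m hxX)
    (hmn' ▸ Y.smul_mem n hyY)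
  exact hm (congrArg Subtype.val h0)
end

section
/- Let R be a ring and let E be an injective R-module admitting an internal direct sum decomposition E = U ⊕ T into submodules U and T, where U is semisimple and injective as an R-module, T is square-free and injective as an R-module, and U and T are orthogonal (no nonzero submodule of U is isomorphic to a submodule of T). Then E is a C4*-module. -/
/-- `M` is square-free if any two submodules with trivial intersection that are isomorphic
as `R`-modules are zero. -/
def IsSquareFreeModule (R M : Type*) [Ring R] [AddCommGroup M] [Module R M] : Prop :=
  ∀ X Y : Submodule R M, X ⊓ Y = ⊥ → Nonempty (X ≃ₗ[R] Y) → X = ⊥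

/-- In a square-free module, a module that embeds twice with disjoint images is zero. -/
theorem IsSquareFreeModule.subsingleton {R M P : Type*} [Ring R] [AddCommGroup M] [Module R M]
    [AddCommGroup P] [Module R P] (h : IsSquareFreeModule R M) (i j : P →ₗ[R] M)
    (hi : Function.Injective i) (hj : Function.Injective j)
    (hij : ∀ p q, i p = j q → i p = 0) : Subsingleton P := by
  have key := h (LinearMap.range i) (LinearMap.range j)
    (by
      rw [eq_bot_iff]
      rintro _ ⟨⟨p, rfl⟩, q, hq⟩
      exact hij p q hq.symm)
    ⟨(LinearEquiv.ofInjective i hi).symm.trans (LinearEquiv.ofInjective j hj)⟩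
  rw [LinearMap.range_eq_bot] at key
  subst key
  exact ⟨fun a b => hi rfl⟩

/-- A module that embeds in two orthogonal modules is zero. -/
theorem subsingleton_of_orthogonal {R U T P : Type*} [Ring R] [AddCommGroup U] [Module R U]
    [AddCommGroup T] [Module R T] [AddCommGroup P] [Module R P]
    (h : ∀ (X : Submodule R U) (Y : Submodule R T), Nonempty (X ≃ₗ[R] Y) → X = ⊥)
    (i : P →ₗ[R] U) (j : P →ₗ[R] T)
    (hi : Function.Injective i) (hj : Function.Injective j) : Subsingleton P := by
  have key := h (LinearMap.range i) (LinearMap.range j)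
    ⟨(LinearEquiv.ofInjective i hi).symm.trans (LinearEquiv.ofInjective j hj)⟩
  rw [LinearMap.range_eq_bot] at key
  subst key
  exact ⟨fun a b => hi rfl⟩

/-- If `E` embeds in `U × T` via `u` and `t`, with `T` square-free and orthogonal to `U`, then of
two embeddings into `E` with disjoint images, the first stays injective after projecting
to `U`. -/
theorem injective_comp_of_disjoint {R E U T P : Type*} [Ring R] [AddCommGroup E] [Module R E]
    [AddCommGroup U] [Module R U] [AddCommGroup T] [Module R T] [AddCommGroup P] [Module R P]
    (hT : IsSquareFreeModule R T)
    (horth : ∀ (X : Submodule R U) (Y : Submodule R T), Nonempty (X ≃ₗ[R] Y) → X = ⊥)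
    (u : E →ₗ[R] U) (t : E →ₗ[R] T) (hut : ∀ x, u x = 0 → t x = 0 → x = 0)
    (a b : P →ₗ[R] E) (ha : Function.Injective a) (hb : Function.Injective b)
    (hab : ∀ p q, a p = b q → a p = 0) : Function.Injective (u ∘ₗ a) := by
  have injOn (c : P →ₗ[R] E) (hc : Function.Injective c) (K : Submodule R P)
      (hK : ∀ p ∈ K, u (c p) = 0) : Function.Injective (t ∘ₗ c ∘ₗ K.subtype) := by
    rw [injective_iff_map_eq_zero]
    intro p hp
    exact Subtype.ext ((map_eq_zero_iff c hc).1 (hut _ (hK p p.2) hp))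
  let D := LinearMap.ker (u ∘ₗ a)
  let Q := D ⊓ LinearMap.ker (u ∘ₗ b)
  have hQ : Subsingleton Q := by
    refine hT.subsingleton _ _ (injOn a ha Q fun p hp => hp.1) (injOn b hb Q fun p hp => hp.2) ?_
    intro p q hpq
    have hp : u (a p) = 0 := p.2.1
    have hq : u (b q) = 0 := q.2.2
    have hpq' : t (a p) = t (b q) := hpq
    have h := hab p q (sub_eq_zero.1 (hut _ (by simp [hp, hq]) (by simp [hpq'])))
    simp [h]
  have hD : Subsingleton D := by
    refine subsingleton_of_orthogonal horth (u ∘ₗ b ∘ₗ D.subtype) (t ∘ₗ a ∘ₗ D.subtype) ?_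
      (injOn a ha D fun p hp => hp)
    rw [injective_iff_map_eq_zero]
    intro p hp
    have h : (⟨p, p.2, hp⟩ : Q) = 0 := Subsingleton.elim _ _
    exact Subtype.ext (congrArg (fun q : Q => (q : P)) h)
  exact LinearMap.ker_eq_bot.1 ((Submodule.subsingleton_iff_eq_bot).1 hD)

/-- The range of a split monomorphism is a direct summand. -/
theorem isDirectSummand_range_of_leftInverse {R M P : Type*} [Ring R] [AddCommGroup M]
    [Module R M] [AddCommGroup P] [Module R P] (g : P →ₗ[R] M) (h : M →ₗ[R] P)
    (hg : ∀ p, h (g p) = p) : IsDirectSummand (LinearMap.range g) := by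
  refine ⟨LinearMap.ker h, ?_, ?_⟩
  · rw [Submodule.disjoint_def]
    rintro _ ⟨p, rfl⟩ hp
    rw [LinearMap.mem_ker, hg] at hp
    rw [hp, map_zero]
  · rw [codisjoint_iff, eq_top_iff]
    intro m _
    exact Submodule.mem_sup.2 ⟨g (h m), ⟨_, rfl⟩, m - g (h m), by simp [hg], by simp⟩

/-- If `E` embeds in `U × T` via `u` and `t`, with `U` semisimple and orthogonal to the square-free
module `T`, then the image of an embedding `g : P → Y`, where `Y` embeds in `E`, is a direct summand
of `Y` as soon as `P` has another embedding into `E` whose image is disjoint from that of `g`. -/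
theorem isDirectSummand_range_of_disjoint {R E U T P Y : Type*} [Ring R]
    [AddCommGroup E] [Module R E] [AddCommGroup U] [Module R U] [AddCommGroup T] [Module R T]
    [AddCommGroup P] [Module R P] [AddCommGroup Y] [Module R Y]
    (hU : IsSemisimpleModule R U) (hT : IsSquareFreeModule R T)
    (horth : ∀ (X : Submodule R U) (Y : Submodule R T), Nonempty (X ≃ₗ[R] Y) → X = ⊥)
    (u : E →ₗ[R] U) (t : E →ₗ[R] T) (hut : ∀ x, u x = 0 → t x = 0 → x = 0)
    (g : P →ₗ[R] Y) (j : Y →ₗ[R] E) (a : P →ₗ[R] E) (hg : Function.Injective g)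
    (hj : Function.Injective j) (ha : Function.Injective a)
    (hga : ∀ p q, j (g p) = a q → j (g p) = 0) : IsDirectSummand (LinearMap.range g) := by
  obtain ⟨r, hr⟩ := IsSemisimpleModule.extension_property (u ∘ₗ j ∘ₗ g)
    (injective_comp_of_disjoint hT horth u t hut (j ∘ₗ g) a (hj.comp hg) ha hga) LinearMap.id
  exact isDirectSummand_range_of_leftInverse g (r ∘ₗ u ∘ₗ j) fun p => LinearMap.congr_fun hr p

/-- An injective module `E = U ⊕ T` with `U` semisimple injective, `T` square-free injective,
and `U`, `T` orthogonal (no nonzero submodule of `U` is isomorphic to a submodule of `T`)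
is a C4*-module. -/
theorem injective_semisimple_plus_squareFree_isC4Star
    {R E : Type*} [Ring R] [AddCommGroup E] [Module R E]
    (hE : Module.Injective R E)
    (U T : Submodule R E) (hUT : IsCompl U T)
    (hU_ss : IsSemisimpleModule R U) (hU_inj : Module.Injective R U)
    (hT_sf : IsSquareFreeModule R T) (hT_inj : Module.Injective R T)
    (horth : ∀ (X : Submodule R U) (Y : Submodule R T), Nonempty (X ≃ₗ[R] Y) → X = ⊥) :
    IsC4StarModule R E := by
  intro N X Y hXY f ⟨C, hC⟩
  obtain ⟨u, t, hut⟩ : ∃ (u : E →ₗ[R] U) (t : E →ₗ[R] T), ∀ x, u x = 0 → t x = 0 → x = 0 := by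
    refine ⟨U.projectionOnto T hUT, T.projectionOnto U hUT.symm, fun x hu ht => ?_⟩
    rw [Submodule.projectionOnto_apply_eq_zero_iff] at hu ht
    exact (Submodule.disjoint_def.1 hUT.disjoint) x ht hu
  let g : C →ₗ[R] Y := f ∘ₗ C.subtype
  have hg : Function.Injective g := by
    rw [injective_iff_map_eq_zero]
    intro c hc
    exact Subtype.ext ((Submodule.disjoint_def.1 hC.disjoint) c hc c.2)
  have hrange : LinearMap.range g = LinearMap.range f := by
    refine le_antisymm (LinearMap.range_comp_le_range _ _) ?_
    rintro _ ⟨x, rfl⟩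
    obtain ⟨k, hk, c, hc, rfl⟩ := Submodule.mem_sup.1 (hC.sup_eq_top ▸ Submodule.mem_top (x := x))
    exact ⟨⟨c, hc⟩, by simp [g, LinearMap.mem_ker.1 hk]⟩
  let a : C →ₗ[R] E := N.subtype ∘ₗ X.subtype ∘ₗ C.subtype
  have ha : Function.Injective a :=
    N.injective_subtype.comp (X.injective_subtype.comp C.injective_subtype)
  rw [← hrange]
  refine isDirectSummand_range_of_disjoint (P := C) (Y := Y) hU_ss hT_sf horth u t hut g
    (N.subtype ∘ₗ Y.subtype) a hg (N.injective_subtype.comp Y.injective_subtype) ha fun p q hpq => ?_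
  have h : (g p : N) = ((q : X) : N) := N.injective_subtype hpq
  have h0 : (g p : N) = 0 :=
    (Submodule.disjoint_def.1 hXY.disjoint) _ (h ▸ (q : X).2) (g p).2
  exact congrArg N.subtype h0
end
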